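/- arXiv:1906.02847 — 2 statements merged into one kernel-verified Lean document; each statement's English description precedes it below -/
import Mathlib

section
/- The natural density β of the set of positive integers n with ω(n) ≡ Ω(n) (mod 2) exists and satisfies 6/π² ≤ β; in particular λ(n) = ξ(n) on a set of density at least 6/π². -/
open Filter ArithmeticFunction

/-- A periodic set of natural numbers has a natural density. -/
lemma tendsto_count_div_of_periodic (p : ℕ → Prop) [DecidablePred p] {M : ℕ} (hM : 0 < M)
    (hp : ∀ n, p (M + n) ↔ p n) :
    Tendsto (fun x : ℕ => (Nat.count p x : ℝ) / x) atTop (nhds ((Nat.count p M : ℝ) / M)) := by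
  have hq : ∀ q r, Nat.count p (M * q + r) = q * Nat.count p M + Nat.count p r := by
    intro q r
    induction q with
    | zero => simp
    | succ q ih =>
      rw [show M * (q + 1) + r = M + (M * q + r) by ring, Nat.count_add]
      simp only [hp]
      rw [ih]
      ring
  have hM' : (0 : ℝ) < M := by exact_mod_cast hM
  rw [tendsto_iff_norm_sub_tendsto_zero]
  refine squeeze_zero' (g := fun x : ℕ => (M : ℝ) / x) (Eventually.of_forall fun _ => norm_nonneg _)
    ?_ (tendsto_const_div_atTop_nhds_zero_nat _)
  filter_upwards [eventually_gt_atTop 0] with x hx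
  have hx' : (0 : ℝ) < x := by exact_mod_cast hx
  have h1 := hq (x / M) (x % M)
  have h2 := Nat.div_add_mod x M
  rw [h2] at h1
  have h3 : Nat.count p (x % M) ≤ x % M := Nat.count_le _
  have h4 : x % M < M := Nat.mod_lt _ hM
  have h5 : Nat.count p M ≤ M := Nat.count_le _
  generalize Nat.count p (x % M) = s at *
  generalize Nat.count p M = C at *
  generalize x % M = r at *
  generalize x / M = q at *
  have h1' : (Nat.count p x : ℝ) = q * C + s := by exact_mod_cast h1
  have h2' : (M : ℝ) * q + r = x := by exact_mod_cast h2
  have h3' : (s : ℝ) ≤ r := by exact_mod_cast h3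
  have h4' : (r : ℝ) ≤ M := by exact_mod_cast h4.le
  have h5' : (C : ℝ) ≤ M := by exact_mod_cast h5
  have hs : (0 : ℝ) ≤ s := Nat.cast_nonneg s
  have hr : (0 : ℝ) ≤ r := Nat.cast_nonneg r
  have hC : (0 : ℝ) ≤ C := Nat.cast_nonneg C
  have key : (Nat.count p x : ℝ) / x - C / M = (s - r * (C / M)) / x := by
    rw [h1']
    field_simp
    rw [← h2']
    ring
  have h6 : (C : ℝ) / M ≤ 1 := (div_le_one hM').2 h5'
  have h7 : 0 ≤ (C : ℝ) / M := by positivity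
  rw [key, Real.norm_eq_abs, abs_div, abs_of_pos hx']
  gcongr
  rw [abs_le]
  constructor <;> nlinarith

open scoped Classical in
/-- The integers up to `x` divisible by the square of an integer exceeding `K` number at most
`x / K`. -/
lemma count_sq_dvd_le {K : ℕ} (hK : K ≠ 0) (x : ℕ) :
    (((Finset.range x).filter (fun n => ∃ d, K < d ∧ d ^ 2 ∣ n + 1)).card : ℝ) ≤ x / K := by
  have hsub : (Finset.range x).filter (fun n => ∃ d, K < d ∧ d ^ 2 ∣ n + 1) ⊆
      (Finset.Ioc K (max K x)).biUnion
        (fun d => (Finset.range x).filter (fun n => d ^ 2 ∣ n + 1)) := by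
    intro n hn
    simp only [Finset.mem_filter, Finset.mem_range, Finset.mem_biUnion, Finset.mem_Ioc] at hn ⊢
    obtain ⟨hnx, d, hKd, hd⟩ := hn
    have := Nat.le_of_dvd (Nat.succ_pos n) hd
    have : d ≤ d ^ 2 := Nat.le_self_pow two_ne_zero d
    exact ⟨d, ⟨hKd, le_max_of_le_right (by omega)⟩, hnx, hd⟩
  have h1 := (Finset.card_le_card hsub).trans Finset.card_biUnion_le
  simp only [Nat.card_multiples] at h1
  calc (((Finset.range x).filter (fun n => ∃ d, K < d ∧ d ^ 2 ∣ n + 1)).card : ℝ)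
      ≤ ∑ d ∈ Finset.Ioc K (max K x), ((x / d ^ 2 : ℕ) : ℝ) := by exact_mod_cast h1
    _ ≤ ∑ d ∈ Finset.Ioc K (max K x), (x : ℝ) * ((d : ℝ) ^ 2)⁻¹ := by
        refine Finset.sum_le_sum fun d _ => ?_
        refine Nat.cast_div_le.trans (le_of_eq ?_)
        push_cast
        rw [div_eq_mul_inv]
    _ = x * ∑ d ∈ Finset.Ioc K (max K x), ((d : ℝ) ^ 2)⁻¹ := by rw [Finset.mul_sum]
    _ ≤ x * (K : ℝ)⁻¹ := by
        gcongr
        refine (sum_Ioc_inv_sq_le_sub hK (le_max_left _ _)).trans ?_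
        have : (0 : ℝ) ≤ ((max K x : ℕ) : ℝ)⁻¹ := by positivity
        linarith
    _ = x / K := by rw [div_eq_mul_inv]

/-- Outside the multiples of squares `d ^ 2` with `d > K`, the integer `n` differs from its
greatest common divisor with `K ! ^ (2 * K)` by a coprime squarefree factor. -/
lemma exists_eq_gcd_mul_squarefree {K n : ℕ} (h : ∀ d, K < d → ¬ d ^ 2 ∣ n) :
    ∃ m, n = n.gcd (K.factorial ^ (2 * K)) * m ∧
      (n.gcd (K.factorial ^ (2 * K))).Coprime m ∧ Squarefree m := by
  obtain ⟨m, hm⟩ := Nat.gcd_dvd_left n (K.factorial ^ (2 * K))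
  have hbig : ∀ p, p.Prime → p ∣ m → K < p := by
    intro p hp hpm
    by_contra! hpK
    have hpow : ∀ j, j ≤ 2 * K → p ^ j ∣ n.gcd (K.factorial ^ (2 * K)) := by
      intro j
      induction j with
      | zero => simp
      | succ j ih =>
        intro hj
        refine Nat.dvd_gcd ?_ ?_
        · rw [hm, pow_succ]
          exact mul_dvd_mul (ih (by omega)) hpm
        · exact (pow_dvd_pow p hj).trans (pow_dvd_pow_of_dvd (Nat.dvd_factorial hp.pos hpK) _)
    refine h (p ^ K) (Nat.lt_pow_self hp.one_lt) ?_
    rw [← pow_mul, mul_comm]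
    exact (hpow _ le_rfl).trans (Nat.gcd_dvd_left _ _)
  refine ⟨m, hm, ?_, ?_⟩
  · refine Nat.coprime_of_dvd fun p hp hpg hpm => ?_
    refine h p (hbig p hp hpm) ?_
    rw [hm, sq]
    exact mul_dvd_mul hpg hpm
  · rw [Nat.squarefree_iff_prime_squarefree]
    intro p hp hpm
    refine h p (hbig p hp ((dvd_mul_right p p).trans hpm)) ?_
    rw [hm, sq]
    exact hpm.mul_left _

/-- The parities of the numbers of prime factors of `n`, with and without multiplicity, agree. -/
def ParityAgree (n : ℕ) : Prop := cardDistinctFactors n % 2 = cardFactors n % 2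

instance : DecidablePred ParityAgree := fun _ => inferInstanceAs (Decidable (_ = _))

lemma cardDistinctFactors_eq_cardFactors_of_squarefree {m : ℕ} (hm : Squarefree m) :
    cardDistinctFactors m = cardFactors m :=
  (cardDistinctFactors_eq_cardFactors_iff_squarefree hm.ne_zero).2 hm

lemma parityAgree_iff_gcd {K n : ℕ} (hn : n ≠ 0) (h : ∀ d, K < d → ¬ d ^ 2 ∣ n) :
    ParityAgree n ↔ ParityAgree (n.gcd (K.factorial ^ (2 * K))) := by
  obtain ⟨m, hm, hc, hs⟩ := exists_eq_gcd_mul_squarefree h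
  have hg : n.gcd (K.factorial ^ (2 * K)) ≠ 0 := Nat.gcd_ne_zero_left hn
  generalize n.gcd (K.factorial ^ (2 * K)) = g at *
  subst hm
  unfold ParityAgree
  rw [cardFactors_mul hg hs.ne_zero, cardDistinctFactors_mul hc,
    cardDistinctFactors_eq_cardFactors_of_squarefree hs]
  omega

lemma abs_count_sub_count_le {p q : ℕ → Prop} [DecidablePred p] [DecidablePred q]
    (r : ℕ → Prop) [DecidablePred r] (h : ∀ n, ¬ r n → (p n ↔ q n)) (x : ℕ) :
    |(Nat.count p x : ℝ) - Nat.count q x| ≤ ((Finset.range x).filter r).card := by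
  have aux : ∀ {p q : ℕ → Prop} [DecidablePred p] [DecidablePred q],
      (∀ n, ¬ r n → (p n ↔ q n)) →
      (Nat.count p x : ℝ) ≤ Nat.count q x + ((Finset.range x).filter r).card := by
    intro p q _ _ h
    rw [Nat.count_eq_card_filter_range, Nat.count_eq_card_filter_range]
    have : (Finset.range x).filter p ⊆ (Finset.range x).filter q ∪ (Finset.range x).filter r := by
      intro n hn
      simp only [Finset.mem_filter, Finset.mem_union] at hn ⊢
      have := h n
      tauto
    exact_mod_cast (Finset.card_le_card this).trans (Finset.card_union_le _ _)
  have h1 := aux h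
  have h2 := aux fun n hn => (h n hn).symm
  rw [abs_le]
  constructor <;> linarith

lemma exists_tendsto_count_parityAgree :
    ∃ β : ℝ, Tendsto (fun x : ℕ => (Nat.count (fun n => ParityAgree (n + 1)) x : ℝ) / x)
      atTop (nhds β) := by
  classical
  refine cauchySeq_tendsto_of_complete (Metric.cauchySeq_iff'.2 fun ε hε => ?_)
  obtain ⟨k, hk⟩ := exists_nat_one_div_lt (show 0 < ε / 4 by linarith)
  set K := k + 1 with hKdef
  set M := K.factorial ^ (2 * K)
  have hM : 0 < M := pow_pos (Nat.factorial_pos K) _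
  have hper := tendsto_count_div_of_periodic (fun n => ParityAgree ((n + 1).gcd M)) hM
    (fun n => by simp [add_assoc])
  obtain ⟨N, hN⟩ := Metric.cauchySeq_iff'.1 hper.cauchySeq (ε / 4) (by linarith)
  have happ : ∀ x : ℕ, |(Nat.count (fun n => ParityAgree (n + 1)) x : ℝ) / x -
      (Nat.count (fun n => ParityAgree ((n + 1).gcd M)) x : ℝ) / x| < ε / 4 := by
    intro x
    rcases Nat.eq_zero_or_pos x with rfl | hx
    · simpa using hε
    have hx' : (0 : ℝ) < x := by exact_mod_cast hx
    rw [← sub_div, abs_div, abs_of_pos hx', div_lt_iff₀ hx']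
    refine (abs_count_sub_count_le (fun n => ∃ d, K < d ∧ d ^ 2 ∣ n + 1) (fun n hn => ?_) x).trans_lt
      ((count_sq_dvd_le (Nat.succ_ne_zero k) x).trans_lt ?_)
    · push Not at hn
      exact parityAgree_iff_gcd (Nat.succ_ne_zero n) hn
    · rw [div_eq_mul_one_div, mul_comm]
      exact mul_lt_mul_of_pos_right (by simpa [hKdef] using hk) hx'
  refine ⟨N, fun x hx => ?_⟩
  have h1 := abs_lt.1 (happ x)
  have h2 := abs_lt.1 (happ N)
  have h3 := hN x hx
  rw [Real.dist_eq, abs_lt] at h3 ⊢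
  constructor <;> linarith [h1.1, h1.2, h2.1, h2.2, h3.1, h3.2]

/-- Every positive integer up to `x` is a square times a squarefree integer. -/
lemma le_sum_count_parityAgree (x : ℕ) :
    x ≤ ∑ a ∈ Finset.range (x + 1), Nat.count (fun n => ParityAgree (n + 1)) (x / a ^ 2) := by
  have hsub : Finset.range x ⊆ (Finset.range (x + 1)).biUnion (fun a =>
      ((Finset.range (x / a ^ 2)).filter (fun n => ParityAgree (n + 1))).image
        (fun n => a ^ 2 * (n + 1) - 1)) := by
    intro n hn
    rw [Finset.mem_range] at hn
    obtain ⟨b, a, hb, ha, hab, hsq⟩ := Nat.sq_mul_squarefree_of_pos (Nat.succ_pos n)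
    simp only [Finset.mem_biUnion, Finset.mem_range, Finset.mem_image, Finset.mem_filter]
    have ha2 : 0 < a ^ 2 := by positivity
    refine ⟨a, ?_, b - 1, ⟨?_, ?_⟩, ?_⟩
    · have : a ≤ a ^ 2 := Nat.le_self_pow two_ne_zero a
      have : a ^ 2 ≤ a ^ 2 * b := Nat.le_mul_of_pos_right _ hb
      grind
    · have : b ≤ x / a ^ 2 := by
        rw [Nat.le_div_iff_mul_le ha2]
        grind
      omega
    · rw [Nat.sub_add_cancel hb]
      exact congrArg (· % 2) (cardDistinctFactors_eq_cardFactors_of_squarefree hsq)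
    · rw [Nat.sub_add_cancel hb]
      grind
  have h := (Finset.card_le_card hsub).trans Finset.card_biUnion_le
  rw [Finset.card_range] at h
  refine h.trans (Finset.sum_le_sum fun a _ => ?_)
  rw [Nat.count_eq_card_filter_range]
  exact Finset.card_image_le

lemma six_div_pi_sq_le_of_tendsto {β : ℝ}
    (hβ : Tendsto (fun x : ℕ => (Nat.count (fun n => ParityAgree (n + 1)) x : ℝ) / x)
      atTop (nhds β)) : 6 / Real.pi ^ 2 ≤ β := by
  set c : ℕ → ℕ := Nat.count (fun n => ParityAgree (n + 1)) with hc
  have hbound : ∀ x a : ℕ, (c (x / a ^ 2) : ℝ) / x ≤ 1 / (a : ℝ) ^ 2 := by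
    intro x a
    rcases Nat.eq_zero_or_pos x with rfl | hx
    · simp
    have hx' : (0 : ℝ) < x := by exact_mod_cast hx
    rw [div_le_iff₀ hx']
    have h1 : (c (x / a ^ 2) : ℝ) ≤ ((x / a ^ 2 : ℕ) : ℝ) := by exact_mod_cast Nat.count_le _
    refine (h1.trans Nat.cast_div_le).trans (le_of_eq ?_)
    push_cast
    ring
  have hlim : Tendsto (fun x : ℕ => ∑' a : ℕ, (c (x / a ^ 2) : ℝ) / x) atTop
      (nhds (∑' a : ℕ, β * (1 / (a : ℝ) ^ 2))) := by
    refine tendsto_tsum_of_dominated_convergence (bound := fun a : ℕ => 1 / (a : ℝ) ^ 2)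
      hasSum_zeta_two.summable (fun a => ?_) (Eventually.of_forall fun x a => ?_)
    · rcases Nat.eq_zero_or_pos a with rfl | ha
      · simp [hc]
      have ha2 : 0 < a ^ 2 := by positivity
      have hdiv : Tendsto (fun x : ℕ => x / a ^ 2) atTop atTop :=
        Nat.tendsto_div_const_atTop ha2.ne'
      have hfloor : Tendsto (fun x : ℕ => ((x / a ^ 2 : ℕ) : ℝ) / x) atTop
          (nhds (1 / (a : ℝ) ^ 2)) := by
        have := (tendsto_nat_floor_mul_div_atTop (R := ℝ)
          (show (0 : ℝ) ≤ 1 / (a : ℝ) ^ 2 by positivity)).comp tendsto_natCast_atTop_atTop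
        refine this.congr fun x => ?_
        simp only [Function.comp]
        rw [one_div_mul_eq_div, ← Nat.cast_pow, Nat.floor_div_eq_div]
      refine ((hβ.comp hdiv).mul hfloor).congr' ?_
      filter_upwards [hdiv.eventually_gt_atTop 0] with x hx
      have hx' : ((x / a ^ 2 : ℕ) : ℝ) ≠ 0 := by exact_mod_cast hx.ne'
      simp only [Function.comp]
      rw [div_mul_div_cancel₀ hx']
    · rw [Real.norm_of_nonneg (by positivity)]
      exact hbound x a
  have hge : (1 : ℝ) ≤ ∑' a : ℕ, β * (1 / (a : ℝ) ^ 2) := by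
    refine ge_of_tendsto hlim ?_
    filter_upwards [eventually_gt_atTop 0] with x hx
    have hx' : (0 : ℝ) < x := by exact_mod_cast hx
    have hsum : Summable fun a : ℕ => (c (x / a ^ 2) : ℝ) / x :=
      hasSum_zeta_two.summable.of_nonneg_of_le (fun a => by positivity) (hbound x)
    refine le_trans ?_ (hsum.sum_le_tsum (Finset.range (x + 1)) fun a _ => by positivity)
    rw [← Finset.sum_div, one_le_div hx']
    exact_mod_cast le_sum_count_parityAgree x
  rw [tsum_mul_left, hasSum_zeta_two.tsum_eq] at hge
  have hpi : 0 < Real.pi ^ 2 := by positivity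
  rw [div_le_iff₀ hpi]
  linarith

theorem density_parity_agree_exists :
    ∃ β : ℝ,
      Tendsto (fun x : ℕ =>
        (((Finset.Icc 1 x).filter (fun n =>
            ArithmeticFunction.cardDistinctFactors n % 2 =
              ArithmeticFunction.cardFactors n % 2)).card : ℝ) / (x : ℝ))
        atTop (nhds β) ∧ 6 / Real.pi ^ 2 ≤ β := by
  obtain ⟨β, hβ⟩ := exists_tendsto_count_parityAgree
  refine ⟨β, hβ.congr fun x => ?_, six_div_pi_sq_le_of_tendsto hβ⟩
  congr 2
  rw [Nat.count_eq_card_filter_range]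
  refine Finset.card_bij (fun n _ => n + 1) (fun n hn => ?_) (fun _ _ _ _ h => by omega)
    (fun n hn => ?_)
  · simp only [Finset.mem_filter, Finset.mem_range, Finset.mem_Icc] at hn ⊢
    exact ⟨by omega, hn.2⟩
  · simp only [Finset.mem_filter, Finset.mem_Icc] at hn
    refine ⟨n - 1, ?_, by omega⟩
    simp only [Finset.mem_filter, Finset.mem_range]
    rw [Nat.sub_add_cancel hn.1.1]
    exact ⟨by omega, hn.2⟩
end

section
/- Let d_k be the density of positive integers n with Ω(n) − ω(n) = k (Rényi's theorem). Then the generating function satisfies ∑_{k≥0} d_k z^k = ∏_p (1 − 1/p)(1 + 1/(p − z)) for |z| < 2, and in particular ∑_{k≥0} d_k = 1 (taking z = 1 gives ∏_p 1 = 1). -/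
open ArithmeticFunction Filter
open scoped Classical

/-- The multiplicative arithmetic function with value `u a` at every prime power `p ^ a`, `a ≠ 0`. -/
noncomputable def ofExponents {R : Type*} [CommRing R] (u : ℕ → R) : ArithmeticFunction R :=
  ⟨fun n => if n = 0 then 0 else n.factorization.prod fun _ a => u a, by simp⟩

section ofExponents

variable {R : Type*} [CommRing R]

theorem ofExponents_apply (u : ℕ → R) {n : ℕ} (hn : n ≠ 0) :
    ofExponents u n = n.factorization.prod fun _ a => u a := by
  simp [ofExponents, hn]

theorem isMultiplicative_ofExponents (u : ℕ → R) : (ofExponents u).IsMultiplicative := by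
  rw [IsMultiplicative.iff_ne_zero]
  refine ⟨by simp [ofExponents_apply], fun {m n} hm hn h => ?_⟩
  rw [ofExponents_apply u hm, ofExponents_apply u hn, ofExponents_apply u (mul_ne_zero hm hn),
    Nat.factorization_mul_of_coprime h, Finsupp.prod_add_index_of_disjoint]
  simpa using h.disjoint_primeFactors

theorem ofExponents_prime_pow {u : ℕ → R} (hu : u 0 = 1) {p : ℕ} (hp : p.Prime) (a : ℕ) :
    ofExponents u (p ^ a) = u a := by
  rw [ofExponents_apply u (pow_ne_zero _ hp.ne_zero), hp.factorization_pow,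
    Finsupp.prod_single_index hu]

theorem map_ofExponents {S : Type*} [CommRing S] (f : R →+* S) (u : ℕ → R) (n : ℕ) :
    f (ofExponents u n) = ofExponents (fun a => f (u a)) n := by
  rcases eq_or_ne n 0 with rfl | hn
  · simp
  · rw [ofExponents_apply _ hn, ofExponents_apply _ hn, map_finsuppProd]

theorem ofExponents_nonneg {u : ℕ → ℝ} (hu : ∀ a, 0 ≤ u a) (n : ℕ) : 0 ≤ ofExponents u n := by
  rcases eq_or_ne n 0 with rfl | hn
  · simp
  · rw [ofExponents_apply _ hn]
    exact Finset.prod_nonneg fun _ _ => hu _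

open Polynomial in
theorem abs_coeff_ofExponents_le {u v : ℕ → ℝ[X]}
    (h : ∀ a k, |(u a).coeff k| ≤ (v a).coeff k) (n k : ℕ) :
    |(ofExponents u n).coeff k| ≤ (ofExponents v n).coeff k := by
  rcases eq_or_ne n 0 with rfl | hn
  · simp
  rw [ofExponents_apply _ hn, ofExponents_apply _ hn, Finsupp.prod, Finsupp.prod]
  induction n.factorization.support using Finset.induction_on generalizing k with
  | empty => by_cases hk : k = 0 <;> simp [coeff_one, hk]
  | insert p s hp ih =>
    rw [Finset.prod_insert hp, Finset.prod_insert hp, coeff_mul, coeff_mul]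
    refine (Finset.abs_sum_le_sum_abs _ _).trans (Finset.sum_le_sum fun x _ => ?_)
    rw [abs_mul]
    exact mul_le_mul (h _ _) (ih _) (abs_nonneg _) ((abs_nonneg _).trans (h _ _))

end ofExponents

/-- The sequence `1, 0, x + c, x (x + c), x² (x + c), …`. For `c = -1` it lists the values at prime
powers of the Möbius transform of `n ↦ x ^ (Ω n - ω n)`. -/
def excessWeight {R : Type*} [CommRing R] (x c : R) : ℕ → R
  | 0 => 1
  | 1 => 0
  | a + 2 => x ^ a * (x + c)

theorem map_excessWeight {R S : Type*} [CommRing R] [CommRing S] (f : R →+* S) (x c : R) (a : ℕ) :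
    f (excessWeight x c a) = excessWeight (f x) (f c) a := by
  match a with
  | 0 => simp [excessWeight]
  | 1 => simp [excessWeight]
  | a + 2 => simp [excessWeight]

theorem sum_range_excessWeight {R : Type*} [CommRing R] (x : R) (a : ℕ) :
    ∑ i ∈ Finset.range (a + 2), excessWeight x (-1) i = x ^ a := by
  induction a with
  | zero => simp [Finset.sum_range_succ, excessWeight]
  | succ a ih =>
    rw [Finset.sum_range_succ, ih, excessWeight]
    ring

theorem hasSum_excessWeight {𝕜 : Type*} [RCLike 𝕜] {x : 𝕜} (c : 𝕜) {p : ℕ} (hp : 0 < p)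
    (hx : ‖x‖ < p) :
    HasSum (fun a => excessWeight x c a / (p : 𝕜) ^ a) (1 + (x + c) / (p * (p - x))) := by
  have hp0 : (p : 𝕜) ≠ 0 := by exact_mod_cast hp.ne'
  have hpx : (p : 𝕜) - x ≠ 0 := by
    intro h
    rw [← sub_eq_zero.mp h, RCLike.norm_natCast] at hx
    exact hx.false
  have hlt : ‖x / p‖ < 1 := by
    rw [norm_div, RCLike.norm_natCast, div_lt_one (by exact_mod_cast hp)]
    exact hx
  have h1 : 1 - x / p ≠ 0 := by
    rw [one_sub_div hp0]
    exact div_ne_zero hpx hp0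
  have hterm (a : ℕ) : excessWeight x c (a + 2) / (p : 𝕜) ^ (a + 2) =
      (x + c) / (p : 𝕜) ^ 2 * (x / p) ^ a := by
    simp only [excessWeight, div_pow]
    field_simp
    ring
  have hval : 1 + (x + c) / (p * (p - x)) -
      ∑ i ∈ Finset.range 2, excessWeight x c i / (p : 𝕜) ^ i =
        (x + c) / (p : 𝕜) ^ 2 * (1 - x / p)⁻¹ := by
    simp only [Finset.sum_range_succ, Finset.sum_range_zero, excessWeight]
    field_simp
    ring
  rw [← hasSum_nat_add_iff' 2, hval]
  simp only [hterm]
  exact (hasSum_geometric_of_norm_lt_one hlt).mul_left _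

/-- A nonnegative multiplicative function is summable as soon as its sums over the nontrivial powers
of each prime are summable over the primes. -/
theorem summable_of_isMultiplicative {F : ℕ → ℝ} (hF : ∀ n, 0 ≤ F n) (h0 : F 0 = 0) (h1 : F 1 = 1)
    (hmul : ∀ {m n : ℕ}, m.Coprime n → F (m * n) = F m * F n) {s : ℕ → ℝ}
    (hs : Summable s) (hs0 : ∀ p, 0 ≤ s p)
    (hsum : ∀ {p : ℕ}, p.Prime → Summable fun a => F (p ^ a))
    (hle : ∀ {p : ℕ}, p.Prime → ∑' a, F (p ^ a) ≤ 1 + s p) : Summable F := by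
  refine summable_of_sum_range_le (c := Real.exp (∑' p, s p)) hF fun N => ?_
  obtain ⟨hS, hprod⟩ := EulerProduct.summable_and_hasSum_smoothNumbers_prod_primesBelow_tsum h1 hmul
    (fun hp => (hsum hp).norm) N
  have hS' : Summable (Set.indicator N.smoothNumbers F) :=
    summable_subtype_iff_indicator.mp hS.of_norm
  calc ∑ n ∈ Finset.range N, F n
      = ∑ n ∈ Finset.range N, Set.indicator N.smoothNumbers F n := by
        refine Finset.sum_congr rfl fun n hn => ?_
        rcases eq_or_ne n 0 with rfl | hn0
        · simp [Set.indicator, h0]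
        · rw [Set.indicator_of_mem]
          exact Nat.mem_smoothNumbers_of_lt hn0.bot_lt (Finset.mem_range.mp hn)
    _ ≤ ∑' n, Set.indicator N.smoothNumbers F n :=
        hS'.sum_le_tsum _ fun n _ => Set.indicator_nonneg (fun n _ => hF n) n
    _ = ∏ p ∈ N.primesBelow, ∑' a, F (p ^ a) := by
        rw [← tsum_subtype, hprod.tsum_eq]
    _ ≤ ∏ p ∈ N.primesBelow, (1 + s p) :=
        Finset.prod_le_prod (fun p _ => tsum_nonneg fun a => hF _)
          fun p hp => hle (Nat.prime_of_mem_primesBelow hp)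
    _ ≤ Real.exp (∑ p ∈ N.primesBelow, s p) := Real.prod_one_add_le_exp_sum _ hs0
    _ ≤ Real.exp (∑' p, s p) := Real.exp_le_exp.mpr (hs.sum_le_tsum _ fun p _ => hs0 p)

theorem excessWeight_nonneg {r : ℝ} (hr : 0 ≤ r) (a : ℕ) : 0 ≤ excessWeight r 1 a := by
  match a with
  | 0 => simp [excessWeight]
  | 1 => simp [excessWeight]
  | a + 2 => simp only [excessWeight]; positivity

theorem summable_ofExponents_excessWeight_div {r : ℝ} (hr : 0 ≤ r) (hr2 : r < 2) :
    Summable fun n : ℕ => ofExponents (excessWeight r 1) n / (n : ℝ) := by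
  have key {p : ℕ} (hp : p.Prime) := hasSum_excessWeight (x := r) 1 hp.pos
    (by rw [Real.norm_of_nonneg hr]; exact hr2.trans_le (by exact_mod_cast hp.two_le))
  have hpow {p : ℕ} (hp : p.Prime) (a : ℕ) :
      ofExponents (excessWeight r 1) (p ^ a) / ((p ^ a : ℕ) : ℝ) =
        excessWeight r 1 a / (p : ℝ) ^ a := by
    rw [ofExponents_prime_pow (by simp [excessWeight]) hp, Nat.cast_pow]
  refine summable_of_isMultiplicative (s := fun p => (r + 1) / (1 - r / 2) * (1 / (p : ℝ) ^ 2))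
    (fun n => div_nonneg (ofExponents_nonneg (excessWeight_nonneg hr) n) n.cast_nonneg) (by simp)
    (by simp [(isMultiplicative_ofExponents (excessWeight r 1)).map_one]) (fun {m n} h => ?_)
    ((Real.summable_one_div_nat_pow.mpr one_lt_two).mul_left _) (fun p => ?_)
    (fun hp => ?_) (fun {p} hp => ?_)
  · rw [(isMultiplicative_ofExponents _).map_mul_of_coprime h, Nat.cast_mul, mul_div_mul_comm]
  · have : 0 < 1 - r / 2 := by linarith
    positivity
  · simpa only [hpow hp] using (key hp).summable
  · simp only [hpow hp, (key hp).tsum_eq]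
    have h1 : 0 < 1 - r / 2 := by linarith
    have h2 : (2 : ℝ) ≤ p := by exact_mod_cast hp.two_le
    rw [div_mul_div_comm, mul_one, add_le_add_iff_left]
    refine div_le_div_of_nonneg_left (by positivity) (by positivity) ?_
    nlinarith [mul_nonneg hr (sub_nonneg.mpr h2)]

/-- Wintner's theorem: if `∑ |g d| / d` converges, then `g * ζ` has mean value `∑ g d / d`. -/
theorem tendsto_sum_mul_zeta_div (g : ArithmeticFunction ℝ)
    (hg : Summable fun d : ℕ => |g d| / (d : ℝ)) :
    Tendsto (fun x : ℕ => (∑ n ∈ Finset.Ioc 0 x, (g * (zeta : ArithmeticFunction ℝ)) n) / (x : ℝ))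
      atTop (nhds (∑' d : ℕ, g d / (d : ℝ))) := by
  have hsum (x : ℕ) : (∑ n ∈ Finset.Ioc 0 x, (g * (zeta : ArithmeticFunction ℝ)) n) / (x : ℝ) =
      ∑' d : ℕ, g d * (((x / d : ℕ) : ℝ) / x) := by
    rw [sum_Ioc_mul_zeta_eq_sum, Finset.sum_div, tsum_eq_sum (s := Finset.Ioc 0 x)]
    · exact Finset.sum_congr rfl fun d _ => mul_div_assoc _ _ _
    · intro d hd
      rcases eq_or_ne d 0 with rfl | hd0
      · simp
      · have : x < d := by simp at hd; omega
        simp [Nat.div_eq_of_lt this]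
  simp only [hsum]
  refine tendsto_tsum_of_dominated_convergence hg (fun d => ?_) (Eventually.of_forall fun x d => ?_)
  · rw [div_eq_mul_inv]
    refine Tendsto.const_mul _ ?_
    refine ((tendsto_nat_floor_mul_div_atTop (R := ℝ) (inv_nonneg.mpr d.cast_nonneg)).comp
      tendsto_natCast_atTop_atTop).congr fun x => ?_
    simp only [Function.comp]
    rw [inv_mul_eq_div, Nat.floor_div_eq_div]
  · rw [norm_mul, Real.norm_eq_abs, div_eq_mul_inv |g d|, Real.norm_of_nonneg (by positivity)]
    refine mul_le_mul_of_nonneg_left ?_ (abs_nonneg _)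
    rcases eq_or_ne x 0 with rfl | hx
    · simp
    · rw [div_le_iff₀ (by positivity), inv_mul_eq_div]
      exact Nat.cast_div_le

open Polynomial

/-- The Möbius transform of `n ↦ X ^ (Ω n - ω n)`. -/
noncomputable def excessTransform : ArithmeticFunction ℝ[X] :=
  ofExponents (excessWeight X (-1))

theorem cardDistinctFactors_le_cardFactors (n : ℕ) :
    cardDistinctFactors n ≤ cardFactors n := by
  rw [cardDistinctFactors_apply, cardFactors_apply]
  exact (List.dedup_sublist _).length_le

theorem excessTransform_mul_zeta_apply {n : ℕ} (hn : n ≠ 0) :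
    (excessTransform * (zeta : ArithmeticFunction ℝ[X])) n =
      X ^ (cardFactors n - cardDistinctFactors n) := by
  let f : ArithmeticFunction ℝ[X] :=
    ⟨fun n => if n = 0 then 0 else X ^ (cardFactors n - cardDistinctFactors n), by simp⟩
  have hf {n : ℕ} (hn : n ≠ 0) : f n = X ^ (cardFactors n - cardDistinctFactors n) := by
    simp [f, hn]
  have hmul : f.IsMultiplicative := by
    rw [IsMultiplicative.iff_ne_zero]
    refine ⟨by simp [hf], fun {m n} hm hn h => ?_⟩
    rw [hf hm, hf hn, hf (mul_ne_zero hm hn), cardFactors_mul hm hn, cardDistinctFactors_mul h,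
      ← pow_add]
    congr 1
    have := cardDistinctFactors_le_cardFactors m
    have := cardDistinctFactors_le_cardFactors n
    omega
  rw [← hf hn]
  congr 1
  refine ((IsMultiplicative.eq_iff_eq_on_prime_powers _
    ((isMultiplicative_ofExponents _).mul isMultiplicative_zeta.natCast) _ hmul).mpr
    fun p i hp => ?_)
  rw [coe_mul_zeta_apply, Nat.sum_divisors_prime_pow hp, hf (pow_ne_zero _ hp.ne_zero),
    cardFactors_apply_prime_pow hp]
  simp only [excessTransform, ofExponents_prime_pow (u := excessWeight (X : ℝ[X]) (-1)) rfl hp]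
  rcases i with _ | i
  · simp [excessWeight]
  · rw [cardDistinctFactors_apply_prime_pow hp i.succ_ne_zero, sum_range_excessWeight,
      Nat.add_sub_cancel]

theorem abs_coeff_excessTransform_le (n k : ℕ) :
    |(excessTransform n).coeff k| ≤ (ofExponents (excessWeight (X : ℝ[X]) 1) n).coeff k := by
  refine abs_coeff_ofExponents_le (fun a k => ?_) n k
  match a with
  | 0 => by_cases hk : k = 0 <;> simp [excessWeight, coeff_one, hk]
  | 1 => simp [excessWeight]
  | a + 2 =>
    simp only [excessWeight, coeff_X_pow_mul', ← sub_eq_add_neg]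
    split_ifs
    · rcases k - a with _ | _ | j <;> simp [coeff_X, coeff_one]
    · simp

theorem hasSum_coeff_mul_pow {R : Type*} [CommRing R] [TopologicalSpace R] (P : R[X]) (z : R) :
    HasSum (fun k => P.coeff k * z ^ k) (P.eval z) := by
  rw [eval_eq_sum, Polynomial.sum]
  refine hasSum_sum_of_ne_finset_zero fun k hk => ?_
  rw [notMem_support_iff.mp hk, zero_mul]

theorem eval_ofExponents_excessWeight (r : ℝ) (n : ℕ) :
    (ofExponents (excessWeight (X : ℝ[X]) 1) n).eval r = ofExponents (excessWeight r 1) n := by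
  rw [← coe_evalRingHom, map_ofExponents]
  simp only [map_excessWeight, map_one, coe_evalRingHom, eval_X]

theorem summable_coeff_excessTransform {r : ℝ} (hr : 0 ≤ r) (hr2 : r < 2) :
    Summable fun x : ℕ × ℕ => |(excessTransform x.1).coeff x.2| / (x.1 : ℝ) * r ^ x.2 := by
  let P (n : ℕ) : ℝ[X] := ofExponents (excessWeight (X : ℝ[X]) 1) n
  have hP (n k : ℕ) : 0 ≤ (P n).coeff k := (abs_nonneg _).trans (abs_coeff_excessTransform_le n k)
  have hsum (n : ℕ) : HasSum (fun k => (P n).coeff k / (n : ℝ) * r ^ k)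
      (ofExponents (excessWeight r 1) n / (n : ℝ)) := by
    rw [← eval_ofExponents_excessWeight]
    exact ((hasSum_coeff_mul_pow (P n) r).div_const (n : ℝ)).congr_fun
      fun k => div_mul_eq_mul_div _ _ _
  have : Summable fun x : ℕ × ℕ => (P x.1).coeff x.2 / (x.1 : ℝ) * r ^ x.2 := by
    refine (summable_prod_of_nonneg fun x => ?_).mpr ⟨fun n => (hsum n).summable, ?_⟩
    · have := hP x.1 x.2
      simp only [Pi.zero_apply]
      positivity
    · simpa only [(hsum _).tsum_eq] using summable_ofExponents_excessWeight_div hr hr2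
  refine this.of_nonneg_of_le (fun x => by positivity) fun x => ?_
  gcongr
  exact abs_coeff_excessTransform_le _ _

theorem tsum_coeff_excessTransform {z : ℂ} (hz : ‖z‖ < 2) :
    ∑' k : ℕ, ((∑' n : ℕ, (excessTransform n).coeff k / (n : ℝ) : ℝ) : ℂ) * z ^ k =
      ∏' p : Nat.Primes, (1 - 1 / (p : ℂ)) * (1 + 1 / ((p : ℂ) - z)) := by
  have hs : Summable fun x : ℕ × ℕ =>
      (((excessTransform x.1).coeff x.2 / (x.1 : ℝ) : ℝ) : ℂ) * z ^ x.2 := by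
    refine Summable.of_norm ((summable_coeff_excessTransform (norm_nonneg z) hz).congr fun x => ?_)
    rw [norm_mul, norm_pow, Complex.norm_real, norm_div, Real.norm_eq_abs, RCLike.norm_natCast]
  have hsum (n : ℕ) :
      HasSum (fun k => (((excessTransform n).coeff k / (n : ℝ) : ℝ) : ℂ) * z ^ k)
        (ofExponents (excessWeight z (-1)) n / (n : ℂ)) := by
    have h : ((excessTransform n).map Complex.ofRealHom).eval z =
        ofExponents (excessWeight z (-1)) n := by
      rw [← coe_mapRingHom, ← coe_evalRingHom, excessTransform, map_ofExponents, map_ofExponents]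
      simp only [map_excessWeight, map_neg, map_one, coe_evalRingHom, coe_mapRingHom, map_X, eval_X]
    rw [← h]
    refine ((hasSum_coeff_mul_pow _ z).div_const (n : ℂ)).congr_fun fun k => ?_
    simp [div_mul_eq_mul_div]
  have hmul : ∀ {m n : ℕ}, m.Coprime n →
      ofExponents (excessWeight z (-1)) (m * n) / ((m * n : ℕ) : ℂ) =
        ofExponents (excessWeight z (-1)) m / (m : ℂ) *
          (ofExponents (excessWeight z (-1)) n / (n : ℂ)) := by
    intro m n h
    rw [(isMultiplicative_ofExponents _).map_mul_of_coprime h, Nat.cast_mul, mul_div_mul_comm]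
  have hnorm : Summable fun n : ℕ => ‖ofExponents (excessWeight z (-1)) n / (n : ℂ)‖ := by
    refine (hs.prod.congr fun n => (hsum n).tsum_eq).norm
  calc _ = ∑' k : ℕ, ∑' n : ℕ, (((excessTransform n).coeff k / (n : ℝ) : ℝ) : ℂ) * z ^ k := by
        refine tsum_congr fun k => ?_
        rw [Complex.ofReal_tsum, tsum_mul_right]
    _ = ∑' n : ℕ, ofExponents (excessWeight z (-1)) n / (n : ℂ) := by
        rw [Summable.tsum_comm (by exact hs)]
        exact tsum_congr fun n => (hsum n).tsum_eq
    _ = ∏' p : Nat.Primes, ∑' a : ℕ,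
          ofExponents (excessWeight z (-1)) ((p : ℕ) ^ a) / (((p : ℕ) ^ a : ℕ) : ℂ) :=
        (EulerProduct.eulerProduct_tprod
          (f := fun n : ℕ => ofExponents (excessWeight z (-1)) n / (n : ℂ))
          (by simp [(isMultiplicative_ofExponents (excessWeight z (-1))).map_one])
          hmul hnorm (by simp)).symm
    _ = _ := by
        refine tprod_congr fun p => ?_
        have hzp : ‖z‖ < (p : ℕ) := hz.trans_le (by exact_mod_cast p.2.two_le)
        have hp0 : ((p : ℕ) : ℂ) ≠ 0 := by exact_mod_cast p.2.ne_zero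
        have hpz : ((p : ℕ) : ℂ) - z ≠ 0 := by
          intro h
          rw [← sub_eq_zero.mp h, RCLike.norm_natCast] at hzp
          exact hzp.false
        simp only [ofExponents_prime_pow (u := excessWeight z (-1)) rfl p.2, Nat.cast_pow]
        rw [(hasSum_excessWeight (-1) p.2.pos hzp).tsum_eq]
        field_simp
        ring

theorem renyi_generating_function :
    ∃ d : ℕ → ℝ,
      (∀ k : ℕ, Tendsto (fun x : ℕ =>
        (((Finset.Icc 1 x).filter (fun n =>
            ArithmeticFunction.cardFactors n -
              ArithmeticFunction.cardDistinctFactors n = k)).card : ℝ) / (x : ℝ))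
        atTop (nhds (d k))) ∧
      (∀ z : ℂ, ‖z‖ < 2 →
        ∑' k : ℕ, (d k : ℂ) * z ^ k =
          ∏' p : Nat.Primes, (1 - 1 / (p : ℂ)) * (1 + 1 / ((p : ℂ) - z))) ∧
      (∑' k : ℕ, d k) = 1 := by
  have gen {z : ℂ} (hz : ‖z‖ < 2) := tsum_coeff_excessTransform hz
  refine ⟨fun k => ∑' n : ℕ, (excessTransform n).coeff k / (n : ℝ), fun k => ?_,
    fun z hz => gen hz, ?_⟩
  · let g : ArithmeticFunction ℝ := ⟨fun n => (excessTransform n).coeff k, by simp⟩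
    have hg : Summable fun d : ℕ => |g d| / (d : ℝ) := by
      have := (summable_coeff_excessTransform zero_le_one one_lt_two).comp_injective
        (Prod.mk_left_injective k)
      simp only [Function.comp_def, one_pow, mul_one] at this
      exact this
    refine (tendsto_sum_mul_zeta_div g hg).congr fun x => ?_
    rw [← Finset.sum_boole]
    congr 1
    refine Finset.sum_congr rfl fun n hn => ?_
    have hn0 : n ≠ 0 := by
      have := Finset.mem_Ioc.mp hn
      omega
    have h := congrArg (fun P : ℝ[X] => P.coeff k) (excessTransform_mul_zeta_apply hn0)
    simp only [coe_mul_zeta_apply, finsetSum_coeff, coeff_X_pow] at h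
    rw [coe_mul_zeta_apply]
    exact h.trans (by simp only [eq_comm])
  · have h := gen (z := 1) (by simp)
    rw [tprod_congr (g := fun _ => 1), tprod_one] at h
    · simp only [one_pow, mul_one] at h
      rw [← Complex.ofReal_tsum] at h
      exact_mod_cast h
    · intro p
      have hp0 : ((p : ℕ) : ℂ) ≠ 0 := by exact_mod_cast p.2.ne_zero
      have hp1 : ((p : ℕ) : ℂ) - 1 ≠ 0 := by
        rw [sub_ne_zero]
        exact_mod_cast p.2.ne_one
      field_simp
      ring
end
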